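/- Let (W,S) be a Coxeter system of finite rank n ≥ 3 such that there exists m ≥ 4 with m_{st} = m for all s ≠ t ∈ S. Set k := (1 - 1/(2(n-2)^{m-2})) · (1/(n-2)^{m-1} + 1)^{-1} ∈ ℝ. Then k > 0 and for every natural number i > m one has (d_i : ℝ) ≥ k · c_i. -/

import Mathlib

namespace CoxAux

open Finset

set_option linter.unusedVariables false

/-! ### Arithmetic part -/

theorem growth_pow (q : ℕ) (d : ℕ → ℕ) (N : ℕ) (h : ∀ j, 1 ≤ j → j < N → q * d j ≤ d (j + 1)) :
    ∀ r j, 1 ≤ j → j + r ≤ N → q ^ r * d j ≤ d (j + r) := by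
  intro r
  induction r with
  | zero => intro j _ _; simp
  | succ r ih =>
    intro j hj hr
    have h1 := ih j hj (by omega)
    have h2 := h (j + r) (by omega) (by omega)
    calc q ^ (r + 1) * d j = q * (q ^ r * d j) := by ring
      _ ≤ q * d (j + r) := Nat.mul_le_mul_left _ h1
      _ ≤ _ := h2

theorem initial_d (q m : ℕ) (d e : ℕ → ℕ)
    (hd1 : d 1 = q + 2) (he0 : ∀ i, i < m → e i = 0)
    (R1 : ∀ i, 1 ≤ i → (q + 1) * d i + q * e i = d (i + 1) + 2 * e (i + 1)) :
    ∀ j, j + 1 < m → d (j + 1) = (q + 2) * (q + 1) ^ j := by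
  intro j
  induction j with
  | zero => intro _; simp [hd1]
  | succ j ih =>
    intro hj
    have h1 := ih (by omega)
    have h2 := R1 (j + 1) (by omega)
    rw [he0 (j + 1) (by omega), he0 (j + 1 + 1) (by omega), h1] at h2
    have : d (j + 1 + 1) = (q + 1) * ((q + 2) * (q + 1) ^ j) := by omega
    rw [this]; ring

/-- `q * e j ≤ d j` from growth below `j`. -/
theorem small_e (q m : ℕ) (hq : 1 ≤ q) (hm : 4 ≤ m) (d e : ℕ → ℕ)
    (hd1 : d 1 = q + 2) (he0 : ∀ i, i < m → e i = 0)
    (R1 : ∀ i, 1 ≤ i → (q + 1) * d i + q * e i = d (i + 1) + 2 * e (i + 1))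
    (hem : 2 * e m = (q + 2) * (q + 1))
    (R2 : ∀ i, 1 ≤ i → 2 * e (i + m) = (q + 1) * q * d i + q * (q - 1) * e i)
    (N : ℕ) (h : ∀ j, 1 ≤ j → j < N → q * d j ≤ d (j + 1)) :
    ∀ j, 1 ≤ j → j ≤ N → q * e j ≤ d j := by
  intro j
  induction j using Nat.strong_induction_on with
  | _ j ih =>
    intro hj hjN
    rcases lt_trichotomy j m with hlt | heq | hgt
    · simp [he0 j hlt]
    · subst heq
      obtain ⟨r, rfl⟩ : ∃ r, j = r + 4 := ⟨j - 4, by omega⟩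
      have h1 := initial_d q (r + 4) d e hd1 he0 R1 (r + 2) (by omega)
      have h2 := R1 (r + 3) (by omega)
      rw [he0 (r + 3) (by omega)] at h2
      have h3 : (q + 1) ^ 2 ≤ (q + 1) ^ (r + 2) := Nat.pow_le_pow_right (by omega) (by omega)
      have h4 : (q + 2) * (q + 1) ^ 2 ≤ d (r + 3) := by
        have := Nat.mul_le_mul_left (q + 2) h3
        simpa [h1] using this
      have h5 : (q + 1) * d (r + 3) = d (r + 4) + (q + 2) * (q + 1) := by
        have : r + 3 + 1 = r + 4 := rfl
        rw [this] at h2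
        omega
      nlinarith [Nat.mul_le_mul_left (q + 1) h4]
    · obtain ⟨i, rfl⟩ : ∃ i, j = i + m := ⟨j - m, by omega⟩
      have hi : 1 ≤ i := by omega
      have h1 := ih i (by omega) hi (by omega)
      have h2 := R2 i hi
      have h3 := growth_pow q d N h m i hi hjN
      have h4 : q ^ 4 * d i ≤ d (i + m) :=
        le_trans (Nat.mul_le_mul_right _ (Nat.pow_le_pow_right hq hm)) h3
      obtain ⟨p, rfl⟩ : ∃ p, q = p + 1 := ⟨q - 1, by omega⟩
      simp only [Nat.add_sub_cancel] at h2
      have h5 := Nat.mul_le_mul_left ((p + 1) * p) h1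
      nlinarith [Nat.zero_le (p * d i), Nat.zero_le (p^2 * d i), Nat.zero_le (p^3 * d i),
        Nat.zero_le (p^4 * d i)]

theorem growth_ge2 (q m : ℕ) (hq : 2 ≤ q) (hm : 4 ≤ m) (d e : ℕ → ℕ)
    (hd1 : d 1 = q + 2) (he0 : ∀ i, i < m → e i = 0)
    (R1 : ∀ i, 1 ≤ i → (q + 1) * d i + q * e i = d (i + 1) + 2 * e (i + 1))
    (hem : 2 * e m = (q + 2) * (q + 1))
    (R2 : ∀ i, 1 ≤ i → 2 * e (i + m) = (q + 1) * q * d i + q * (q - 1) * e i) :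
    ∀ j, 1 ≤ j → q * d j ≤ d (j + 1) := by
  intro j
  induction j using Nat.strong_induction_on with
  | _ j ih =>
    intro hj
    have hG : ∀ i, 1 ≤ i → i < j → q * d i ≤ d (i + 1) := fun i h1 h2 => ih i h2 h1
    have hr := R1 j hj
    suffices 2 * e (j + 1) ≤ d j + q * e j by nlinarith
    rcases lt_trichotomy (j + 1) m with hlt | heq | hgt
    · simp [he0 (j + 1) hlt]
    · obtain ⟨r, rfl⟩ : ∃ r, j = r + 3 := ⟨j - 3, by omega⟩
      have h1 := initial_d q m d e hd1 he0 R1 (r + 2) (by omega)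
      have h3 : (q + 1) ^ 1 ≤ (q + 1) ^ (r + 2) := Nat.pow_le_pow_right (by omega) (by omega)
      have h4 : (q + 2) * (q + 1) ^ 1 ≤ d (r + 3) := by
        have := Nat.mul_le_mul_left (q + 2) h3
        simpa [h1] using this
      rw [heq, hem]
      nlinarith
    · obtain ⟨p, hp⟩ : ∃ p, j + 1 = p + m := ⟨j + 1 - m, by omega⟩
      have hp1 : 1 ≤ p := by omega
      have h1 := small_e q m (by omega) hm d e hd1 he0 R1 hem R2 j hG p hp1 (by omega)
      have h3 := growth_pow q d j hG (j - p) p hp1 (by omega)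
      rw [show p + (j - p) = j by omega] at h3
      have h4 : q ^ 3 * d p ≤ d j :=
        le_trans (Nat.mul_le_mul_right _ (Nat.pow_le_pow_right (by omega) (by omega))) h3
      rw [hp, R2 p hp1]
      obtain ⟨a, rfl⟩ : ∃ a, q = a + 2 := ⟨q - 2, by omega⟩
      rw [show a + 2 - 1 = a + 1 by omega]
      have h5 : (a + 2) * (a + 1) * e p ≤ (a + 1) * d p := by
        nlinarith [Nat.mul_le_mul_left (a + 1) h1]
      nlinarith [Nat.zero_le (a * d p), Nat.zero_le (a^2 * d p), Nat.zero_le (a^3 * d p)]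

theorem growth_one (m : ℕ) (hm : 4 ≤ m) (d e : ℕ → ℕ)
    (hd1 : d 1 = 3) (he0 : ∀ i, i < m → e i = 0)
    (R1 : ∀ i, 1 ≤ i → 2 * d i + e i = d (i + 1) + 2 * e (i + 1))
    (hem : e m = 3)
    (R2 : ∀ i, 1 ≤ i → e (i + m) = d i) :
    ∀ j, 1 ≤ j → 3 * d j ≤ 2 * d (j + 1) := by
  have hinit := initial_d 1 m d e hd1 he0 (by intro i hi; have := R1 i hi; omega)
  intro j
  induction j using Nat.strong_induction_on with
  | _ j ih =>
    intro hj
    have hr := R1 j hj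
    have hG : ∀ i, 1 ≤ i → i < j → 1 * d i ≤ d (i + 1) := fun i h1 h2 => by
      have := ih i h2 h1; omega
    have hsm := small_e 1 m le_rfl hm d e hd1 he0 (by intro i hi; have := R1 i hi; omega)
      (by omega) (by intro i hi; have := R2 i hi; simp; omega) j hG
    have hbig : ∀ r, j = r + 3 ∨ j = r + 4 → r + 4 = m → 12 ≤ d (r + 3) := by
      intro r _ h
      have h1 := hinit (r + 2) (by omega)
      have h3 : 2 ^ 2 ≤ 2 ^ (r + 2) := Nat.pow_le_pow_right (by omega) (by omega)
      have : d (r + 3) = (1 + 2) * (1 + 1) ^ (r + 2) := h1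
      norm_num at this h3
      omega
    rcases lt_trichotomy (j + 1) m with hlt | heq | hgt
    · rw [he0 (j + 1) hlt] at hr; omega
    · obtain ⟨r, rfl⟩ : ∃ r, j = r + 3 := ⟨j - 3, by omega⟩
      have := hbig r (by omega) (by omega)
      rw [heq, hem] at hr
      rw [heq]
      omega
    · rcases Nat.eq_or_lt_of_le (show m ≤ j by omega) with h | h
      · subst h
        have h1 := R2 1 le_rfl
        obtain ⟨r, rfl⟩ : ∃ r, m = r + 4 := ⟨m - 4, by omega⟩
        have := hbig r (by omega) (by omega)
        have h2 := R1 (r + 3) (by omega)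
        rw [show r + 3 + 1 = r + 4 by omega] at h2
        rw [add_comm] at h1
        omega
      · obtain ⟨p, rfl⟩ : ∃ p, j = p + 1 + m := ⟨j - m - 1, by omega⟩
        have h1 := R2 (p + 1) (by omega)
        have h2 := R2 (p + 2) (by omega)
        rw [show p + 2 + m = p + 1 + m + 1 by omega] at h2
        have h3 := R1 (p + 1) (by omega)
        have h4 := hsm (p + 1) (by omega) (by omega)
        have g1 := ih (p + 2) (by omega) (by omega)
        have g2 := ih (p + 3) (by omega) (by omega)
        have g3 := ih (p + 4) (by omega) (by omega)
        have h5 := growth_pow 1 d (p + 1 + m) hG (m - 4) (p + 5) (by omega) (by omega)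
        rw [show p + 5 + (m - 4) = p + 1 + m by omega] at h5
        simp only [one_pow, one_mul] at h5
        simp only [Nat.add_assoc, Nat.reduceAdd] at *
        omega

theorem final_ineq (q m : ℕ) (hq : 1 ≤ q) (hm : 4 ≤ m) (d e : ℕ → ℕ)
    (hd1 : d 1 = q + 2) (he0 : ∀ i, i < m → e i = 0)
    (R1 : ∀ i, 1 ≤ i → (q + 1) * d i + q * e i = d (i + 1) + 2 * e (i + 1))
    (hem : 2 * e m = (q + 2) * (q + 1))
    (R2 : ∀ i, 1 ≤ i → 2 * e (i + m) = (q + 1) * q * d i + q * (q - 1) * e i)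
    (i : ℕ) (hi : m < i) : 2 * q ^ (m - 1) * e i ≤ (q + 2) * d i := by
  have hG : ∀ j, 1 ≤ j → q * d j ≤ d (j + 1) := by
    rcases Nat.eq_or_lt_of_le hq with h | h
    · subst h
      intro j hj
      have := growth_one m hm d e hd1 he0 (by intro i hi; have := R1 i hi; omega)
        (by omega) (by intro i hi; have := R2 i hi; simp at this; omega) j hj
      omega
    · exact growth_ge2 q m h hm d e hd1 he0 R1 hem R2
  obtain ⟨j, rfl⟩ : ∃ j, i = j + m := ⟨i - m, by omega⟩
  have hj : 1 ≤ j := by omega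
  have h1 := small_e q m hq hm d e hd1 he0 R1 hem R2 j (fun i h _ => hG i h) j hj le_rfl
  have h2 := R2 j hj
  have h3 := growth_pow q d (j + m) (fun i h _ => hG i h) m j hj le_rfl
  obtain ⟨r, rfl⟩ : ∃ r, m = r + 1 := ⟨m - 1, by omega⟩
  obtain ⟨p, rfl⟩ : ∃ p, q = p + 1 := ⟨q - 1, by omega⟩
  simp only [Nat.add_sub_cancel] at h2 ⊢
  have h4 : 2 * e (j + (r + 1)) ≤ (p + 1) * (p + 3) * d j := by
    nlinarith [Nat.mul_le_mul_left p h1]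
  calc 2 * (p + 1) ^ r * e (j + (r + 1)) = (p + 1) ^ r * (2 * e (j + (r + 1))) := by ring
    _ ≤ (p + 1) ^ r * ((p + 1) * (p + 3) * d j) := Nat.mul_le_mul_left _ h4
    _ = (p + 3) * ((p + 1) ^ (r + 1) * d j) := by ring
    _ ≤ (p + 3) * d (j + (r + 1)) := Nat.mul_le_mul_left _ h3

theorem k_facts (q m : ℕ) (hq : 1 ≤ q) (hm : 4 ≤ m) (k : ℝ)
    (hk : k = (1 - 1 / (2 * (q : ℝ) ^ (m - 2))) * (1 / (q : ℝ) ^ (m - 1) + 1)⁻¹) :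
    0 < k ∧ ∀ d e : ℕ, 2 * q ^ (m - 1) * e ≤ (q + 2) * d → k * ((d + e : ℕ) : ℝ) ≤ (d : ℝ) := by
  obtain ⟨r, rfl⟩ : ∃ r, m = r + 2 := ⟨m - 2, by omega⟩
  rw [show r + 2 - 2 = r by omega, show r + 2 - 1 = r + 1 by omega] at *
  have hQ : (1 : ℝ) ≤ q := by exact_mod_cast hq
  have hP : (1 : ℝ) ≤ (q : ℝ) ^ r := one_le_pow₀ hQ
  set P := (q : ℝ) ^ r with hPdef
  have hk' : k = (2 * P - 1) * q / (2 * (1 + P * q)) := by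
    rw [hk, pow_succ, ← hPdef]
    field_simp
  constructor
  · rw [hk']
    have : 0 < 2 * P - 1 := by linarith
    positivity
  · intro d e h
    have h' : 2 * (P * q) * (e : ℝ) ≤ (q + 2) * d := by
      have : ((2 * q ^ (r + 1) * e : ℕ) : ℝ) ≤ (((q + 2) * d : ℕ) : ℝ) := by exact_mod_cast h
      push_cast at this
      rw [pow_succ] at this
      exact this
    rw [hk', div_mul_eq_mul_div, div_le_iff₀ (by positivity)]
    push_cast
    have he : (0 : ℝ) ≤ q * e := by positivity
    nlinarith

end CoxAux

namespace CoxAux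

open Finset

/-! ### The reflection cocycle -/

section
variable {B : Type*} {W : Type*} [Group W] {M : CoxeterMatrix B} (cs : CoxeterSystem M W)

open Classical in
/-- The action of a simple reflection on `W × ZMod 2`. -/
noncomputable def act (i : B) : W × ZMod 2 → W × ZMod 2 :=
  fun x => (cs.simple i * x.1 * cs.simple i, x.2 + if x.1 = cs.simple i then 1 else 0)

theorem dconj_pow {a b : W} (ha : a * a = 1) (hb : b * b = 1) (k : ℕ) :
    b * (a * b) ^ k * b = ((a * b) ^ k)⁻¹ := by
  have hai : a⁻¹ = a := inv_eq_of_mul_eq_one_left ha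
  have hbi : b⁻¹ = b := inv_eq_of_mul_eq_one_left hb
  have h1 : b * (a * b) ^ k * b⁻¹ = (b * (a * b) * b⁻¹) ^ k := by rw [_root_.conj_pow]
  rw [hbi] at h1
  rw [h1, ← inv_pow]
  congr 1
  simp [mul_assoc, hai, hbi, hb]

open Classical in
theorem act_iter (i j : B) (k : ℕ) (x : W × ZMod 2) :
    ((act cs i ∘ act cs j)^[k]) x =
      ((cs.simple i * cs.simple j) ^ k * x.1 * ((cs.simple i * cs.simple j) ^ k)⁻¹,
        x.2 + ∑ l ∈ range (2 * k),
          if x.1 = ((cs.simple i * cs.simple j) ^ l)⁻¹ * cs.simple j then 1 else 0) := by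
  have ha := cs.simple_mul_simple_self i
  have hb := cs.simple_mul_simple_self j
  have hai := cs.inv_simple i
  have hbi := cs.inv_simple j
  have hcp := dconj_pow (W := W) ha hb
  generalize hga : cs.simple i = a at *
  generalize hgb : cs.simple j = b at *
  induction k with
  | zero => simp
  | succ k ih =>
    rw [Function.iterate_succ_apply', ih]
    have key : ∀ k, b * (a * b) ^ k = ((a * b) ^ k)⁻¹ * b := by
      intro k; rw [← hcp k, mul_assoc, hb, mul_one]
    simp only [act, Function.comp, hga, hgb]
    ext
    · simp [pow_succ', mul_assoc, hai, hbi]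
    · rw [show 2 * (k + 1) = 2 * k + 1 + 1 by ring, sum_range_succ, sum_range_succ]
      simp only [add_assoc]
      have e1 : ((a * b) ^ k * x.1 * ((a * b) ^ k)⁻¹ = b) ↔
          x.1 = ((a * b) ^ (2 * k))⁻¹ * b := by
        rw [mul_inv_eq_iff_eq_mul, key, two_mul, pow_add, mul_inv_rev, mul_assoc _ _ b,
          eq_inv_mul_iff_mul_eq, eq_inv_mul_iff_mul_eq, eq_inv_mul_iff_mul_eq]
      have e2 : (b * ((a * b) ^ k * x.1 * ((a * b) ^ k)⁻¹) * b = a) ↔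
          x.1 = ((a * b) ^ (2 * k + 1))⁻¹ * b := by
        have : b * a * b = (a * b)⁻¹ * b := by simp [hai, hbi]
        constructor
        · intro h
          have h' : (a * b) ^ k * x.1 * ((a * b) ^ k)⁻¹ = b * a * b := by
            generalize (a * b) ^ k * x.1 * ((a * b) ^ k)⁻¹ = y at h ⊢
            rw [← h]; simp only [mul_assoc, hb, mul_one]
            rw [← mul_assoc b b, hb, one_mul]
          rw [mul_inv_eq_iff_eq_mul, this, mul_assoc, key, ← eq_inv_mul_iff_mul_eq] at h'
          rw [h', show 2 * k + 1 = k + (1 + k) by ring, pow_add, pow_add, pow_one]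
          simp only [mul_inv_rev, mul_assoc]
        · intro h
          have h' : (a * b) ^ k * x.1 * ((a * b) ^ k)⁻¹ = b * a * b := by
            rw [mul_inv_eq_iff_eq_mul, this, mul_assoc, key, ← eq_inv_mul_iff_mul_eq]
            rw [h, show 2 * k + 1 = k + (1 + k) by ring, pow_add, pow_add, pow_one]
            simp only [mul_inv_rev, mul_assoc]
          rw [h']
          simp only [mul_assoc, hb, mul_one]
          rw [← mul_assoc b b, hb, one_mul]
      simp only [e1, e2]

theorem act_liftable : M.IsLiftable
    (G := Function.End (W × ZMod 2)) (fun i => act cs i) := by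
  classical
  intro i j
  have h : ∀ (f : Function.End (W × ZMod 2)) (k : ℕ) x, (f ^ k) x = f^[k] x := by
    intro f k
    induction k with
    | zero => intro x; rfl
    | succ k ih =>
      intro x
      rw [pow_succ]
      exact ih (f x)
  funext x
  rw [h]
  have := act_iter cs i j (M i j) x
  refine this.trans ?_
  rw [cs.simple_mul_simple_pow]
  have hz : ∀ z : ZMod 2, z + z = 0 := by decide
  rw [two_mul, sum_range_add]
  simp only [pow_add, cs.simple_mul_simple_pow, one_mul]
  rw [hz]
  simp
  rfl

/-- The homomorphism from `W` to self-maps of `W × ZMod 2`. -/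
noncomputable def actHom : W →* Function.End (W × ZMod 2) := cs.lift ⟨_, act_liftable cs⟩

/-- The reflection cocycle. -/
noncomputable def eta (w t : W) : ZMod 2 := (actHom cs w (t, 0)).2

theorem actHom_simple (i : B) : actHom cs (cs.simple i) = act cs i :=
  cs.lift_apply_simple (act_liftable cs) i

theorem actHom_apply (w t : W) (z : ZMod 2) :
    actHom cs w (t, z) = (w * t * w⁻¹, z + eta cs w t) := by
  unfold eta
  induction w using cs.simple_induction_left generalizing t z with
  | one => simp [Function.End.one_def]
  | mul_simple_left w i ih =>
    have h : ∀ z, actHom cs (cs.simple i * w) (t, z) = act cs i (actHom cs w (t, z)) := by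
      intro z; rw [map_mul, actHom_simple]; rfl
    rw [h, h, ih t z, ih t 0]
    simp [act, mul_assoc, add_assoc]

theorem eta_mul (v w t : W) : eta cs (v * w) t = eta cs w t + eta cs v (w * t * w⁻¹) := by
  have : actHom cs (v * w) (t, 0) = actHom cs v (actHom cs w (t, 0)) := by rw [map_mul]; rfl
  have h2 := congrArg Prod.snd this
  rw [actHom_apply, actHom_apply, actHom_apply] at h2
  simpa using h2

theorem eta_one (t : W) : eta cs 1 t = 0 := by
  simp [eta, Function.End.one_def]

open Classical in
theorem eta_simple (i : B) (t : W) : eta cs (cs.simple i) t = if t = cs.simple i then 1 else 0 := by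
  simp [eta, actHom_simple, act]

theorem length_lt_of_eta (w t : W) (h : eta cs w t ≠ 0) : cs.length (w * t) < cs.length w := by
  have key : ∀ ω : List B, eta cs (cs.wordProd ω) t ≠ 0 →
      cs.length (cs.wordProd ω * t) < ω.length := by
    intro ω
    induction ω with
    | nil => simp [eta_one]
    | cons a ω ih =>
      intro h
      rw [cs.wordProd_cons, eta_mul, eta_simple] at h
      rw [cs.wordProd_cons, List.length_cons]
      split_ifs at h with h1
      · rw [mul_inv_eq_iff_eq_mul] at h1
        rw [mul_assoc, h1, cs.simple_mul_simple_cancel_left]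
        exact Nat.lt_succ_of_le (cs.length_wordProd_le ω)
      · have := ih (by simpa using h)
        have h2 := cs.length_mul_le (cs.simple a) (cs.wordProd ω * t)
        rw [cs.length_simple, ← mul_assoc] at h2
        omega
  obtain ⟨ω, hω, rfl⟩ := cs.exists_isReduced w
  rw [hω.eq]
  exact key ω h

theorem zmod2 (z : ZMod 2) : z = 0 ∨ z = 1 := by revert z; decide

theorem desc_iff (w : W) (i : B) :
    cs.length (w * cs.simple i) < cs.length w ↔ eta cs w (cs.simple i) = 1 := by
  constructor
  · intro h
    by_contra h1
    have h0 : eta cs w (cs.simple i) = 0 := (zmod2 _).resolve_right h1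
    have : eta cs (w * cs.simple i) (cs.simple i) ≠ 0 := by
      rw [eta_mul, eta_simple]; simp [h0]
    have := length_lt_of_eta cs _ _ this
    rw [cs.simple_mul_simple_cancel_right] at this
    omega
  · intro h
    exact length_lt_of_eta cs _ _ (by simp [h])

theorem length_succ_of_eta_zero (w : W) (i : B) (h : eta cs w (cs.simple i) = 0) :
    cs.length (w * cs.simple i) = cs.length w + 1 := by
  rcases cs.length_mul_simple w i with h1 | h1
  · exact h1
  · have := (desc_iff cs w i).1 (by omega)
    simp [h] at this

/-! ### Dihedral subgroups -/

/-- Alternating products: `alt i j k` has `k` letters and ends in `j`. -/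
def alt : B → B → ℕ → W
  | _, _, 0 => 1
  | i, j, k + 1 => alt j i k * cs.simple j

theorem alt_mul_pow (i j : B) (k : ℕ) :
    alt cs i j k * (cs.simple j * cs.simple i) ^ k = alt cs j i k := by
  induction k generalizing i j with
  | zero => simp [alt]
  | succ k ih =>
    rw [alt, alt, ← ih j i]
    have hc : (cs.simple i * cs.simple j) ^ k * cs.simple i =
        cs.simple i * (cs.simple j * cs.simple i) ^ k := by
      clear ih
      induction k with
      | zero => simp
      | succ k ih2 =>
        rw [pow_succ', mul_assoc, ih2, pow_succ']
        simp only [mul_assoc]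
    simp only [mul_assoc]
    rw [hc, pow_succ']
    simp only [mul_assoc, cs.simple_mul_simple_cancel_left]

theorem alt_swap {m : ℕ} (hM : ∀ s t : B, s ≠ t → orderOf (cs.simple s * cs.simple t) = m)
    {i j : B} (hij : i ≠ j) : alt cs i j m = alt cs j i m := by
  rw [← alt_mul_pow cs i j m, ← hM j i hij.symm, pow_orderOf_eq_one, mul_one]

theorem eta_alt {m : ℕ} (hM : ∀ s t : B, s ≠ t → orderOf (cs.simple s * cs.simple t) = m)
    (k l : ℕ) (hkl : k + l < m) {i j : B} (hij : i ≠ j) :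
    eta cs (alt cs j i k) ((cs.simple j * cs.simple i) ^ l * cs.simple j) = 0 := by
  induction k generalizing l i j with
  | zero => simp [alt, eta_one]
  | succ k ih =>
    rw [alt, eta_mul, eta_simple, if_neg, zero_add]
    · have := ih (l + 1) (by omega) hij.symm
      convert this using 2
      rw [cs.inv_simple]
      have hc : ∀ l, (cs.simple i * cs.simple j) ^ l * cs.simple i =
          cs.simple i * (cs.simple j * cs.simple i) ^ l := by
        intro l
        induction l with
        | zero => simp
        | succ k ih2 =>
          rw [pow_succ', mul_assoc, mul_assoc, pow_succ', ih2]
          simp only [mul_assoc]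
      rw [hc, pow_succ]
      simp only [mul_assoc]
    · intro h
      have h1 : (cs.simple j * cs.simple i) ^ (l + 1) = 1 := by
        rw [pow_succ, ← mul_assoc, h, cs.simple_mul_simple_self]
      have h2 := orderOf_dvd_of_pow_eq_one h1
      rw [hM j i hij.symm] at h2
      have := Nat.le_of_dvd (by omega) h2
      omega

/-- The dihedral subgroup. -/
def dih (i j : B) : Subgroup W := Subgroup.closure {cs.simple i, cs.simple j}

theorem dih_left (i j : B) : cs.simple i ∈ dih cs i j := Subgroup.subset_closure (by simp)
theorem dih_right (i j : B) : cs.simple j ∈ dih cs i j := Subgroup.subset_closure (by simp)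

theorem dih_comm (i j : B) : dih cs i j = dih cs j i := by
  unfold dih; rw [Set.pair_comm]

theorem alt_mem (i j : B) (k : ℕ) : alt cs i j k ∈ dih cs i j := by
  induction k generalizing i j with
  | zero => exact one_mem _
  | succ k ih => exact mul_mem (dih_comm cs j i ▸ ih j i) (dih_right cs i j)

theorem mem_dih {m : ℕ} (hm : 1 ≤ m)
    (hM : ∀ s t : B, s ≠ t → orderOf (cs.simple s * cs.simple t) = m)
    {i j : B} (hij : i ≠ j) (x : W) (hx : x ∈ dih cs i j) :
    ∃ k ≤ m, x = alt cs i j k ∨ x = alt cs j i k := by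
  have step : ∀ (i j : B), i ≠ j → ∀ k ≤ m, ∀ x,
      x = alt cs i j k ∨ x = alt cs j i k →
      ∃ k' ≤ m, x * cs.simple j = alt cs i j k' ∨ x * cs.simple j = alt cs j i k' := by
    intro i j hij k hk x hx
    have h1 : ∀ k ≤ m, ∃ k' ≤ m, alt cs i j k * cs.simple j = alt cs i j k' ∨
        alt cs i j k * cs.simple j = alt cs j i k' := by
      intro k hk
      cases k with
      | zero => exact ⟨1, hm, Or.inl (by simp [alt])⟩
      | succ k => exact ⟨k, by omega, Or.inr (by simp [alt])⟩
    rcases hx with rfl | rfl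
    · exact h1 k hk
    · rcases Nat.eq_or_lt_of_le hk with h | h
      · subst h
        rw [← alt_swap cs hM hij]
        exact h1 k le_rfl
      · exact ⟨k + 1, h, Or.inl rfl⟩
  unfold dih at hx
  have step2 : ∀ (x y : W), y ∈ ({cs.simple i, cs.simple j} : Set W) →
      (∃ k ≤ m, x = alt cs i j k ∨ x = alt cs j i k) →
      (∃ k ≤ m, x * y = alt cs i j k ∨ x * y = alt cs j i k) := by
    rintro x y hy ⟨k, hk, h⟩
    rcases hy with rfl | rfl
    · obtain ⟨k', h1, h2⟩ := step j i hij.symm k hk x h.symm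
      exact ⟨k', h1, h2.symm⟩
    · exact step i j hij k hk x h
  induction hx using Subgroup.closure_induction_right with
  | one => exact ⟨0, by omega, Or.inl rfl⟩
  | mul_right x hx y hy ih => exact step2 x y hy ih
  | mul_inv_cancel x hx y hy ih =>
    have : y⁻¹ = y := by rcases hy with rfl | rfl <;> simp
    rw [this]; exact step2 x y hy ih

/-- `u` is minimal in its coset of the dihedral subgroup. -/
def IsMin (i j : B) (u : W) : Prop := ∀ x ∈ dih cs i j, eta cs u x = 0

theorem exists_min (i j : B) (w : W) : ∃ u v, w = u * v ∧ v ∈ dih cs i j ∧ IsMin cs i j u := by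
  classical
  have hex : ∃ n, ∃ v ∈ dih cs i j, cs.length (w * v) = n := ⟨_, 1, one_mem _, rfl⟩
  obtain ⟨v, hv, hl⟩ := Nat.find_spec hex
  refine ⟨w * v, v⁻¹, by simp, inv_mem hv, ?_⟩
  intro x hx
  by_contra h
  have h1 := length_lt_of_eta cs _ _ h
  rw [hl] at h1
  exact Nat.find_min hex h1 ⟨v * x, mul_mem hv hx, by rw [mul_assoc]⟩

theorem IsMin.eta_mul {i j : B} {u : W} (hu : IsMin cs i j u) {v x : W} (hv : v ∈ dih cs i j)
    (hx : x ∈ dih cs i j) : eta cs (u * v) x = eta cs v x := by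
  rw [CoxAux.eta_mul, hu _ (mul_mem (mul_mem hv hx) (inv_mem hv)), add_zero]

theorem IsMin.symm {i j : B} {u : W} (hu : IsMin cs i j u) : IsMin cs j i u := by
  unfold IsMin; rw [dih_comm]; exact hu


theorem eta_alt_zero {m : ℕ} (hm : 4 ≤ m)
    (hM : ∀ s t : B, s ≠ t → orderOf (cs.simple s * cs.simple t) = m) {k : ℕ} (hk : k < m) {i j : B} (hij : i ≠ j) :
    eta cs (alt cs j i k) (cs.simple j) = 0 := by
  have := eta_alt cs hM k 0 (by omega) hij
  simpa using this

theorem eta_alt_one {m : ℕ} (hm : 4 ≤ m)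
    (hM : ∀ s t : B, s ≠ t → orderOf (cs.simple s * cs.simple t) = m) {k : ℕ} (hk : k < m) {i j : B} (hij : i ≠ j) :
    eta cs (alt cs i j (k + 1)) (cs.simple j) = 1 := by
  rw [alt, eta_mul, eta_simple, if_pos rfl]
  have := eta_alt_zero cs hm hM hk hij
  simpa using this

theorem isMin_of {m : ℕ} (hm : 4 ≤ m)
    (hM : ∀ s t : B, s ≠ t → orderOf (cs.simple s * cs.simple t) = m) (i j : B) (hij : i ≠ j) (w : W) (hi : eta cs w (cs.simple i) = 0)
    (hj : eta cs w (cs.simple j) = 0) : IsMin cs i j w := by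
  obtain ⟨u, v, rfl, hv, hu⟩ := exists_min cs i j w
  rw [hu.eta_mul cs hv (dih_left cs i j)] at hi
  rw [hu.eta_mul cs hv (dih_right cs i j)] at hj
  obtain ⟨k, hk, h⟩ := mem_dih cs (by omega) hM hij v hv
  cases k with
  | zero =>
    have : v = 1 := by rcases h with h | h <;> exact h
    rw [this, mul_one]; exact hu
  | succ k =>
    rcases h with rfl | rfl
    · rw [eta_alt_one cs hm hM (by omega) hij] at hj; simp at hj
    · rw [eta_alt_one cs hm hM (by omega) hij.symm] at hi; simp at hi

theorem length_min_alt {m : ℕ} (hm : 4 ≤ m)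
    (hM : ∀ s t : B, s ≠ t → orderOf (cs.simple s * cs.simple t) = m) {i j : B} (hij : i ≠ j) {u : W} (hu : IsMin cs i j u) {k : ℕ} (hk : k ≤ m) :
    cs.length (u * alt cs i j k) = cs.length u + k := by
  induction k generalizing i j with
  | zero => simp [alt]
  | succ k ih =>
    rw [alt, ← mul_assoc, length_succ_of_eta_zero, ih hij.symm (hu.symm cs) (by omega)]
    · rfl
    · rw [(hu.symm cs).eta_mul cs (alt_mem cs j i k) (dih_left cs j i),
        eta_alt_zero cs hm hM (by omega) hij]

theorem eta_long_right {m : ℕ} (hm : 4 ≤ m)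
    (hM : ∀ s t : B, s ≠ t → orderOf (cs.simple s * cs.simple t) = m) {i j : B} (hij : i ≠ j) : eta cs (alt cs i j m) (cs.simple j) = 1 := by
  obtain ⟨r, rfl⟩ : ∃ r, m = r + 1 := ⟨m - 1, by omega⟩
  exact eta_alt_one cs hm hM (by omega) hij

theorem eta_long_left {m : ℕ} (hm : 4 ≤ m)
    (hM : ∀ s t : B, s ≠ t → orderOf (cs.simple s * cs.simple t) = m) {i j : B} (hij : i ≠ j) : eta cs (alt cs i j m) (cs.simple i) = 1 := by
  rw [alt_swap cs hM hij]
  exact eta_long_right cs hm hM hij.symm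

theorem isMin_of_two {m : ℕ} (hm : 4 ≤ m)
    (hM : ∀ s t : B, s ≠ t → orderOf (cs.simple s * cs.simple t) = m) {i j : B} (hij : i ≠ j) (w : W) (hi : eta cs w (cs.simple i) = 1)
    (hj : eta cs w (cs.simple j) = 1) : IsMin cs i j (w * (alt cs i j m)⁻¹) := by
  obtain ⟨u, v, rfl, hv, hu⟩ := exists_min cs i j w
  rw [hu.eta_mul cs hv (dih_left cs i j)] at hi
  rw [hu.eta_mul cs hv (dih_right cs i j)] at hj
  obtain ⟨k, hk, h⟩ := mem_dih cs (by omega) hM hij v hv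
  rcases Nat.eq_or_lt_of_le hk with h1 | h1
  · subst h1
    rw [← alt_swap cs hM hij, or_self] at h
    rw [h]; simpa using hu
  · rcases h with rfl | rfl
    · rw [eta_alt_zero cs hm hM h1 hij.symm] at hi; simp at hi
    · rw [eta_alt_zero cs hm hM h1 hij] at hj; simp at hj

/-! ### At most two descents -/

/-- The element obtained by reading the periodic word `x 0, x 1, …`. -/
def per (x : ℕ → B) : ℕ → W
  | 0 => 1
  | k + 1 => per x k * cs.simple (x k)

theorem per_desc {m : ℕ} (hm : 4 ≤ m)
    (hM : ∀ s t : B, s ≠ t → orderOf (cs.simple s * cs.simple t) = m) (x : ℕ → B) (hp : ∀ k, x (k + 3) = x k) (h01 : ∀ k, x k ≠ x (k + 1))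
    (h02 : ∀ k, x k ≠ x (k + 2)) (k : ℕ) :
    eta cs (per cs x k) (cs.simple (x k)) = 0 ∧ eta cs (per cs x k) (cs.simple (x (k + 1))) = 0 := by
  induction k using Nat.strong_induction_on with
  | _ k ih =>
    match k with
    | 0 => simp [per, eta_one]
    | 1 =>
      have h0 := ih 0 (by omega)
      simp only [per, one_mul, eta_simple]
      have hinj : ∀ a b : B, a ≠ b → cs.simple a ≠ cs.simple b := by
        intro a b hab h
        have := hM a b hab
        rw [h, cs.simple_mul_simple_self, orderOf_one] at this
        omega
      rw [if_neg (hinj _ _ (h01 0).symm), if_neg (hinj _ _ (h02 0).symm)]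
      simp
    | k + 2 =>
      have h0 := ih k (by omega)
      have h1 := ih (k + 1) (by omega)
      constructor
      · -- coset of x (k+1), x (k+2)
        have hmin := isMin_of cs hm hM (x (k + 1)) (x (k + 2)) (h01 _) _ h1.1 h1.2
        have e : per cs x (k + 2) = per cs x (k + 1) * alt cs (x (k + 2)) (x (k + 1)) 1 := by
          simp [per, alt]
        rw [e, hmin.eta_mul cs (dih_comm cs _ _ ▸ alt_mem cs _ _ _) (dih_right cs _ _)]
        exact eta_alt_zero cs hm hM (by omega) (h01 _)
      · rw [show k + 2 + 1 = k + 3 by omega, hp k]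
        have hmin := isMin_of cs hm hM (x k) (x (k + 1)) (h01 _) _ h0.1 h0.2
        have e : per cs x (k + 2) = per cs x k * alt cs (x k) (x (k + 1)) 2 := by
          simp [per, alt, mul_assoc]
        rw [e, hmin.eta_mul cs (alt_mem cs _ _ _) (dih_left cs _ _)]
        exact eta_alt_zero cs hm hM (by omega) (h01 _).symm

theorem no_three {m : ℕ} (hm : 4 ≤ m)
    (hM : ∀ s t : B, s ≠ t → orderOf (cs.simple s * cs.simple t) = m) (a b c : B) (hab : a ≠ b) (hac : a ≠ c) (hbc : b ≠ c) (w : W)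
    (ha : eta cs w (cs.simple a) = 1) (hb : eta cs w (cs.simple b) = 1)
    (hc : eta cs w (cs.simple c) = 1) : False := by
  let x : ℕ → B := fun k => if k % 3 = 0 then a else if k % 3 = 1 then b else c
  have hp : ∀ k, x (k + 3) = x k := by intro k; simp [x]
  have hcase : ∀ k, (x k = a ∧ x (k + 1) = b ∧ x (k + 2) = c) ∨
      (x k = b ∧ x (k + 1) = c ∧ x (k + 2) = a) ∨ (x k = c ∧ x (k + 1) = a ∧ x (k + 2) = b) := by
    intro k
    have : k % 3 = 0 ∨ k % 3 = 1 ∨ k % 3 = 2 := by omega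
    rcases this with h | h | h
    · left
      have h1 : (k + 1) % 3 = 1 := by omega
      have h2 : (k + 2) % 3 = 2 := by omega
      simp [x, h, h1, h2]
    · right; left
      have h1 : (k + 1) % 3 = 2 := by omega
      have h2 : (k + 2) % 3 = 0 := by omega
      simp [x, h, h1, h2]
    · right; right
      have h1 : (k + 1) % 3 = 0 := by omega
      have h2 : (k + 2) % 3 = 1 := by omega
      simp [x, h, h1, h2]
  have h01 : ∀ k, x k ≠ x (k + 1) := by
    intro k
    rcases hcase k with ⟨h1, h2, h3⟩ | ⟨h1, h2, h3⟩ | ⟨h1, h2, h3⟩ <;> rw [h1, h2]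
    exacts [hab, hbc, hac.symm]
  have h02 : ∀ k, x k ≠ x (k + 2) := by
    intro k
    rcases hcase k with ⟨h1, h2, h3⟩ | ⟨h1, h2, h3⟩ | ⟨h1, h2, h3⟩ <;> rw [h1, h3]
    exacts [hac, hab.symm, hbc.symm]
  have hx : ∀ k, eta cs w (cs.simple (x k)) = 1 := by
    intro k
    rcases hcase k with ⟨h1, h2, h3⟩ | ⟨h1, h2, h3⟩ | ⟨h1, h2, h3⟩ <;> rw [h1] <;> assumption
  have hpd := per_desc cs hm hM x hp h01 h02
  have hlen : ∀ k, cs.length (per cs x k) ≤ k := by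
    intro k
    induction k with
    | zero => simp [per]
    | succ k ih =>
      have := cs.length_mul_le (per cs x k) (cs.simple (x k))
      rw [cs.length_simple] at this
      simp only [per]; omega
  have key : ∀ k, cs.length (w * (per cs x k)⁻¹) + k ≤ cs.length w := by
    intro k
    induction k with
    | zero => simp [per]
    | succ k ih =>
      have h1 := hx k
      have h2 : w = (w * (per cs x k)⁻¹) * per cs x k := by simp
      rw [h2, eta_mul, (hpd k).1, zero_add] at h1
      have h3 := length_lt_of_eta cs _ _ (by rw [h1]; simp)
      have h4 : w * (per cs x k)⁻¹ * (per cs x k * cs.simple (x k) * (per cs x k)⁻¹) =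
          w * (per cs x (k + 1))⁻¹ := by
        simp [per, mul_assoc]
      rw [h4] at h3
      omega
  have := key (cs.length w + 1)
  omega

end

end CoxAux

namespace CoxAux

open Finset

/-! ### Counting -/

section
variable {B : Type*} [Fintype B] {W : Type*} [Group W] {M : CoxeterMatrix B}
  (cs : CoxeterSystem M W)

theorem finite_level (i : ℕ) : {w : W | cs.length w = i}.Finite := by
  refine ((List.finite_length_eq B i).image cs.wordProd).subset ?_
  rintro w rfl
  obtain ⟨ω, hω, rfl⟩ := cs.exists_isReduced w
  exact ⟨ω, hω.eq.symm, rfl⟩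

/-- Elements of length `i`. -/
noncomputable def level (i : ℕ) : Finset W := (finite_level cs i).toFinset

theorem mem_level (i : ℕ) (w : W) : w ∈ level cs i ↔ cs.length w = i := by simp [level]

open Classical in
/-- Right descents. -/
noncomputable def des (w : W) : Finset B := univ.filter fun s => eta cs w (cs.simple s) = 1

theorem mem_des (w : W) (s : B) : s ∈ des cs w ↔ eta cs w (cs.simple s) = 1 := by simp [des]

open Classical in
/-- Right ascents. -/
noncomputable def asc (w : W) : Finset B := univ.filter fun s => eta cs w (cs.simple s) = 0

theorem mem_asc (w : W) (s : B) : s ∈ asc cs w ↔ eta cs w (cs.simple s) = 0 := by simp [asc]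

theorem card_asc (w : W) : (asc cs w).card + (des cs w).card = Fintype.card B := by
  classical
  have : des cs w = (asc cs w)ᶜ := by
    ext s
    rw [mem_compl, mem_des, mem_asc]
    rcases zmod2 (eta cs w (cs.simple s)) with h | h <;> simp [h]
  rw [this, card_add_card_compl]

theorem mem_asc_iff (w : W) (s : B) : s ∈ asc cs w ↔ cs.length (w * cs.simple s) = cs.length w + 1 := by
  rw [mem_asc]
  constructor
  · exact length_succ_of_eta_zero cs w s
  · intro h
    refine (zmod2 _).resolve_right fun h1 => ?_
    have := (desc_iff cs w s).2 h1
    omega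

theorem mem_des_iff (w : W) (s : B) : s ∈ des cs w ↔ cs.length (w * cs.simple s) + 1 = cs.length w := by
  rw [mem_des, ← desc_iff]
  rcases cs.length_mul_simple w s with h | h <;> omega

theorem sum_asc (i : ℕ) :
    ∑ w ∈ level cs i, (asc cs w).card = ∑ w ∈ level cs (i + 1), (des cs w).card := by
  rw [← card_sigma, ← card_sigma]
  refine card_nbij' (fun p => ⟨p.1 * cs.simple p.2, p.2⟩) (fun p => ⟨p.1 * cs.simple p.2, p.2⟩)
    ?_ ?_ ?_ ?_
  · rintro ⟨w, s⟩ h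
    simp only [coe_sigma, Set.mem_sigma_iff, mem_coe, mem_level, mem_asc_iff, mem_des_iff,
      cs.simple_mul_simple_cancel_right] at h ⊢
    omega
  · rintro ⟨w, s⟩ h
    simp only [coe_sigma, Set.mem_sigma_iff, mem_coe, mem_level, mem_asc_iff, mem_des_iff,
      cs.simple_mul_simple_cancel_right] at h ⊢
    omega
  · rintro ⟨w, s⟩ h; simp
  · rintro ⟨w, s⟩ h; simp


theorem length_two {m : ℕ} (hm : 4 ≤ m)
    (hM : ∀ s t : B, s ≠ t → orderOf (cs.simple s * cs.simple t) = m) {i j : B} (hij : i ≠ j) (w : W) (hi : eta cs w (cs.simple i) = 1)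
    (hj : eta cs w (cs.simple j) = 1) :
    cs.length w = cs.length (w * (alt cs i j m)⁻¹) + m := by
  have h := isMin_of_two cs hm hM hij w hi hj
  have := length_min_alt cs hm hM hij h le_rfl
  rw [← this]; simp

theorem sum_offDiag {m : ℕ} (hm : 4 ≤ m)
    (hM : ∀ s t : B, s ≠ t → orderOf (cs.simple s * cs.simple t) = m) [DecidableEq B] (i : ℕ) :
    ∑ w ∈ level cs i, (asc cs w).offDiag.card = ∑ w ∈ level cs (i + m), (des cs w).offDiag.card := by
  rw [← card_sigma, ← card_sigma]
  refine card_nbij' (fun p => ⟨p.1 * alt cs p.2.1 p.2.2 m, p.2⟩)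
    (fun p => ⟨p.1 * (alt cs p.2.1 p.2.2 m)⁻¹, p.2⟩) ?_ ?_ ?_ ?_
  · rintro ⟨w, s, t⟩ h
    simp only [coe_sigma, Set.mem_sigma_iff, mem_coe, mem_level, mem_offDiag, mem_asc,
      mem_des] at h ⊢
    obtain ⟨h1, h2, h3, h4⟩ := h
    have hmin := isMin_of cs hm hM s t h4 w h2 h3
    refine ⟨?_, ?_, ?_, h4⟩
    · rw [length_min_alt cs hm hM h4 hmin le_rfl, h1]
    · rw [hmin.eta_mul cs (alt_mem cs _ _ _) (dih_left cs _ _), eta_long_left cs hm hM h4]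
    · rw [hmin.eta_mul cs (alt_mem cs _ _ _) (dih_right cs _ _), eta_long_right cs hm hM h4]
  · rintro ⟨w, s, t⟩ h
    simp only [coe_sigma, Set.mem_sigma_iff, mem_coe, mem_level, mem_offDiag, mem_asc,
      mem_des] at h ⊢
    obtain ⟨h1, h2, h3, h4⟩ := h
    have hmin := isMin_of_two cs hm hM h4 w h2 h3
    have hl := length_two cs hm hM h4 w h2 h3
    exact ⟨by omega, hmin _ (dih_left cs _ _), hmin _ (dih_right cs _ _), h4⟩
  · rintro ⟨w, s, t⟩ h; simp
  · rintro ⟨w, s, t⟩ h; simp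

theorem card_des_le {m : ℕ} (hm : 4 ≤ m)
    (hM : ∀ s t : B, s ≠ t → orderOf (cs.simple s * cs.simple t) = m) (w : W) : (des cs w).card ≤ 2 := by
  classical
  by_contra h
  obtain ⟨a, b, c, ha, hb, hc, hab, hac, hbc⟩ := two_lt_card_iff.1 (not_le.1 h)
  rw [mem_des] at ha hb hc
  exact no_three cs hm hM a b c hab hac hbc w ha hb hc

theorem card_des_pos {m : ℕ} (hm : 4 ≤ m)
    (hM : ∀ s t : B, s ≠ t → orderOf (cs.simple s * cs.simple t) = m) {i : ℕ} (hi : 1 ≤ i) (w : W) (hw : w ∈ level cs i) : 1 ≤ (des cs w).card := by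
  rw [mem_level] at hw
  have h1 : w ≠ 1 := by rintro rfl; simp at hw; omega
  obtain ⟨s, hs⟩ := cs.exists_rightDescent_of_ne_one h1
  exact card_pos.2 ⟨s, (mem_des cs w s).2 ((desc_iff cs w s).1 hs)⟩

/-- Elements of length `i` with `r` descents. -/
noncomputable def cnt (r i : ℕ) : ℕ := ((level cs i).filter fun w => (des cs w).card = r).card

theorem sum_split {m : ℕ} (hm : 4 ≤ m)
    (hM : ∀ s t : B, s ≠ t → orderOf (cs.simple s * cs.simple t) = m) {i : ℕ} (hi : 1 ≤ i) (f : ℕ → ℕ) :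
    ∑ w ∈ level cs i, f (des cs w).card = f 1 * cnt cs 1 i + f 2 * cnt cs 2 i := by
  have h : ∀ w ∈ level cs i, f (des cs w).card =
      (if (des cs w).card = 1 then f 1 else 0) + (if (des cs w).card = 2 then f 2 else 0) := by
    intro w hw
    have h1 := card_des_le cs hm hM w
    have h2 := card_des_pos cs hm hM hi w hw
    have : (des cs w).card = 1 ∨ (des cs w).card = 2 := by omega
    rcases this with h | h <;> simp [h]
  rw [sum_congr rfl h, sum_add_distrib, ← sum_filter, ← sum_filter, sum_const, sum_const, cnt, cnt,
    smul_eq_mul, smul_eq_mul, mul_comm, mul_comm (f 2)]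

theorem main {m : ℕ} (hm : 4 ≤ m)
    (hM : ∀ s t : B, s ≠ t → orderOf (cs.simple s * cs.simple t) = m) (q : ℕ) (hq : 1 ≤ q) (hn : Fintype.card B = q + 2) (i : ℕ) (hi : m < i) :
    2 * q ^ (m - 1) * cnt cs 2 i ≤ (q + 2) * cnt cs 1 i := by
  classical
  have hasc : ∀ w, (asc cs w).card = q + 2 - (des cs w).card := by
    intro w; have := card_asc cs w; omega
  have h0 : level cs 0 = {1} := by ext w; simp [mem_level, cs.length_eq_zero_iff]
  have hd0 : des cs 1 = ∅ := by ext s; simp [mem_des, eta_one]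
  have he0 : ∀ i, i < m → cnt cs 2 i = 0 := by
    intro i hi
    rw [cnt, card_eq_zero, filter_eq_empty_iff]
    intro w hw h2
    obtain ⟨a, b, hab, h⟩ := card_eq_two.1 h2
    have ha : a ∈ des cs w := by simp [h]
    have hb : b ∈ des cs w := by simp [h]
    rw [mem_des] at ha hb
    have := length_two cs hm hM hab w ha hb
    rw [mem_level] at hw
    omega
  refine final_ineq q m hq hm (cnt cs 1) (cnt cs 2) ?_ he0 ?_ ?_ ?_ i hi
  · have h := sum_asc cs 0
    rw [h0, sum_singleton, hasc, hd0, sum_split cs hm hM (by omega) (fun x => x)] at h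
    have := he0 1 (by omega)
    simp at h; omega
  · intro i hi
    have h := sum_asc cs i
    simp only [hasc] at h
    rw [sum_split cs hm hM hi (fun x => q + 2 - x), sum_split cs hm hM (by omega) (fun x => x)] at h
    simp at h; omega
  · have h := sum_offDiag cs hm hM 0
    simp only [offDiag_card, hasc] at h
    rw [h0, sum_singleton, hd0, sum_split cs hm hM (by omega) (fun x => x * x - x)] at h
    simp at h
    rw [← h]
    have : (q + 2) * (q + 2) = (q + 2) * (q + 1) + (q + 2) := by ring
    omega
  · intro i hi
    have h := sum_offDiag cs hm hM i
    simp only [offDiag_card, hasc] at h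
    rw [sum_split cs hm hM hi (fun x => (q + 2 - x) * (q + 2 - x) - (q + 2 - x)),
      sum_split cs hm hM (by omega) (fun x => x * x - x)] at h
    simp at h
    rw [← h]
    obtain ⟨p, rfl⟩ : ∃ p, q = p + 1 := ⟨q - 1, by omega⟩
    have e1 : (p + 1 + 1) * (p + 1 + 1) - (p + 1 + 1) = (p + 1 + 1) * (p + 1) := by
      rw [Nat.sub_eq_iff_eq_add (by nlinarith)]; ring
    have e2 : (p + 1) * (p + 1) - (p + 1) = (p + 1) * p := by
      rw [Nat.sub_eq_iff_eq_add (by nlinarith)]; ring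
    simp [e1, e2]

theorem main_card {m : ℕ} (hm : 4 ≤ m)
    (hM : ∀ s t : B, s ≠ t → orderOf (cs.simple s * cs.simple t) = m) {i : ℕ} (hi : 1 ≤ i) : (level cs i).card = cnt cs 1 i + cnt cs 2 i := by
  have := sum_split cs hm hM hi (fun _ => 1)
  simpa using this

end

end CoxAux


/-- Let `(W, S)` be a Coxeter system of finite rank `n ≥ 3` such that there exists `m ≥ 4`
with `m s t = m` for all `s ≠ t` in `S`. Let `c i` be the number of elements of length `i`
and `d i` the number of elements of length `i` with exactly one right descent. Set
`k := (1 - 1/(2 (n-2)^(m-2))) * (1/(n-2)^(m-1) + 1)⁻¹`. Then `k > 0` and for every `i > m`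
one has `d i ≥ k * c i`. -/
theorem exists_k_d_ge_k_mul_c
    {B : Type*} [Fintype B] {W : Type*} [Group W] {M : CoxeterMatrix B}
    (cs : CoxeterSystem M W) (n : ℕ) (hn : Fintype.card B = n) (hn3 : 3 ≤ n)
    (m : ℕ) (hm : 4 ≤ m)
    (hM : ∀ s t : B, s ≠ t → orderOf (cs.simple s * cs.simple t) = m)
    (c d : ℕ → ℕ)
    (hc : ∀ i, c i = Nat.card {w : W // cs.length w = i})
    (hd : ∀ i, d i = Nat.card {w : W // cs.length w = i ∧
      ∃! s : B, cs.length (w * cs.simple s) < cs.length w})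
    (k : ℝ)
    (hk : k = (1 - 1 / (2 * ((n : ℝ) - 2) ^ (m - 2))) * (1 / ((n : ℝ) - 2) ^ (m - 1) + 1)⁻¹) :
    0 < k ∧ ∀ i : ℕ, m < i → k * (c i : ℝ) ≤ (d i : ℝ) := by
  classical
  obtain ⟨q, rfl⟩ : ∃ q, n = q + 2 := ⟨n - 2, by omega⟩
  have hcast : (((q + 2 : ℕ) : ℝ) - 2) = (q : ℝ) := by push_cast; ring
  rw [hcast] at hk
  obtain ⟨hk0, hk1⟩ := CoxAux.k_facts q m (by omega) hm k hk
  refine ⟨hk0, fun i hi => ?_⟩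
  have hci : c i = CoxAux.cnt cs 1 i + CoxAux.cnt cs 2 i := by
    rw [hc, ← CoxAux.main_card cs hm hM (by omega)]
    exact Nat.subtype_card _ (CoxAux.mem_level cs i)
  have hdi : d i = CoxAux.cnt cs 1 i := by
    rw [hd, CoxAux.cnt]
    refine Nat.subtype_card _ fun w => ?_
    rw [Finset.mem_filter, CoxAux.mem_level, Finset.card_eq_one]
    refine and_congr_right fun _ => ?_
    simp only [CoxAux.desc_iff, ← CoxAux.mem_des, Finset.eq_singleton_iff_unique_mem]
    rfl
  rw [hci, hdi]
  exact hk1 _ _ (CoxAux.main cs hm hM q (by omega) hn i hi)
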